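/- Let f be a norm on ℝ^n and let (θ_ν)_{ν≥1} be a sequence of points of B_f^1 such that for each ν the point 0, regarded as a boundary point of the ball B_f^1(θ_ν), is illuminated from the point θ_{ν+1} (in particular f(θ_ν) = 1, f(θ_{ν+1} − θ_ν) > 1, and there exists λ > 0 with f(−λθ_{ν+1} − θ_ν) < 1). Then there exists a vector α = (α₁,…,α_n) ∈ ℝ^n with 1, α₁, …, α_n linearly independent over ℚ such that lim_{ν→∞} |Ξ_ν − θ_ν| = 0, where Ξ_ν are the normalized remainder vectors of the f-b.s.a. sequence of α. -/

import Mathlib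

open scoped BigOperators

/-- `f` is a (symmetric convex gauge) norm on `ℝ^n`. -/
structure IsGaugeNorm {n : ℕ} (f : (Fin n → ℝ) → ℝ) : Prop where
  continuous : Continuous f
  nonneg : ∀ x, 0 ≤ f x
  eq_zero_iff : ∀ x, f x = 0 ↔ x = 0
  neg : ∀ x, f (-x) = f x
  smul : ∀ t : ℝ, 0 ≤ t → ∀ x, f (t • x) = t * f x
  add_le : ∀ x y, f (x + y) ≤ f x + f y

/-- The remainder vector `ξ = p·α − a`. -/
noncomputable def xiv {n : ℕ} (α : Fin n → ℝ) (p : ℤ) (a : Fin n → ℤ) : Fin n → ℝ :=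
  fun j => (p : ℝ) * α j - (a j : ℝ)

/-- `(p, a)` with `p ≥ 1` is an `f`-best simultaneous approximation to `α`. -/
def IsFBSA {n : ℕ} (f : (Fin n → ℝ) → ℝ) (α : Fin n → ℝ) (p : ℤ) (a : Fin n → ℤ) : Prop :=
  1 ≤ p ∧
  (∀ (q : ℤ) (b : Fin n → ℤ), 1 ≤ q → q ≤ p - 1 → f (xiv α p a) < f (xiv α q b)) ∧
  (∀ b : Fin n → ℤ, b ≠ a → f (xiv α p a) < f (xiv α p b))

/-- `τ : ℕ → ℤ × ℤ^n` is the (exhaustive) sequence of all `f`-b.s.a. to `α`,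
with strictly increasing `p_ν`. -/
def IsFBSASeq {n : ℕ} (f : (Fin n → ℝ) → ℝ) (α : Fin n → ℝ)
    (τ : ℕ → ℤ × (Fin n → ℤ)) : Prop :=
  (∀ ν : ℕ, IsFBSA f α (τ ν).1 (τ ν).2) ∧
  (∀ ν : ℕ, (τ ν).1 < (τ (ν + 1)).1) ∧
  (∀ (p : ℤ) (a : Fin n → ℤ), IsFBSA f α p a → ∃ ν : ℕ, τ ν = (p, a))

/-- The normalized remainder `Ξ_ν = ξ_ν / f(ξ_ν)`. -/
noncomputable def Xiv {n : ℕ} (f : (Fin n → ℝ) → ℝ) (α : Fin n → ℝ)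
    (τ : ℕ → ℤ × (Fin n → ℤ)) (ν : ℕ) : Fin n → ℝ :=
  (f (xiv α (τ ν).1 (τ ν).2))⁻¹ • xiv α (τ ν).1 (τ ν).2

/-- `f` is strictly convex: the boundary of its unit ball contains no line segment. -/
def StrictlyConvexNorm {n : ℕ} (f : (Fin n → ℝ) → ℝ) : Prop :=
  ∀ x y : Fin n → ℝ, f x = 1 → f y = 1 → x ≠ y →
    ∀ t : ℝ, t ∈ Set.Ioo (0 : ℝ) 1 → f (t • x + (1 - t) • y) < 1

namespace IsGaugeNorm

variable {n : ℕ} {f : (Fin n → ℝ) → ℝ}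

lemma map_zero (hf : IsGaugeNorm f) : f 0 = 0 := (hf.eq_zero_iff 0).2 rfl

lemma pos (hf : IsGaugeNorm f) {x : Fin n → ℝ} (hx : x ≠ 0) : 0 < f x :=
  lt_of_le_of_ne (hf.nonneg x) fun h => hx ((hf.eq_zero_iff x).1 h.symm)

lemma smul_abs (hf : IsGaugeNorm f) (t : ℝ) (x : Fin n → ℝ) : f (t • x) = |t| * f x := by
  rcases le_total 0 t with h | h
  · rw [hf.smul t h, abs_of_nonneg h]
  · rw [← hf.neg, ← neg_smul, hf.smul (-t) (by linarith), abs_of_nonpos h]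

lemma sub_comm (hf : IsGaugeNorm f) (x y : Fin n → ℝ) : f (x - y) = f (y - x) := by
  rw [← hf.neg, neg_sub]

lemma le_add_sub (hf : IsGaugeNorm f) (x y : Fin n → ℝ) : f x ≤ f y + f (x - y) := by
  simpa using hf.add_le y (x - y)

lemma exists_norm_le (hf : IsGaugeNorm f) : ∃ C : ℝ, 0 < C ∧ ∀ x, ‖x‖ ≤ C * f x := by
  obtain ⟨m, hm, hle⟩ := (isCompact_sphere (0 : Fin n → ℝ) 1).exists_forall_le'
    hf.continuous.continuousOn (a := 0)
    fun x hx => hf.pos fun h => by simp [h] at hx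
  refine ⟨m⁻¹, inv_pos.2 hm, fun x => ?_⟩
  by_cases hx : x = 0
  · simp [hx, hf.map_zero]
  have hx' : 0 < ‖x‖ := norm_pos_iff.2 hx
  have h := hle (‖x‖⁻¹ • x) (by simp [norm_smul, hx'.ne'])
  rw [hf.smul _ (by positivity)] at h
  rw [← div_eq_inv_mul, le_div_iff₀ hm]
  rw [← div_eq_inv_mul, le_div_iff₀ hx'] at h
  linarith

/-- Moving against a direction in which a norm can be decreased strictly increases it. -/
lemma lt_sub_smul (hf : IsGaugeNorm f) {y u : Fin n → ℝ} {l m : ℝ} (hl : 0 < l) (hm : 0 < m)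
    (h : f (y + l • u) < f y) : f y < f (y - m • u) := by
  have e : (l + m) • y = m • (y + l • u) + l • (y - m • u) := by
    ext j; simp; ring
  have h1 := hf.add_le (m • (y + l • u)) (l • (y - m • u))
  rw [← e, hf.smul _ (by positivity), hf.smul _ hm.le, hf.smul _ hl.le] at h1
  nlinarith

/-- Illumination of a boundary point is an open condition. -/
lemma exists_illumination_radius (hf : IsGaugeNorm f) {x y : Fin n → ℝ} (hx : f x = 1) {l : ℝ}
    (hl : 0 < l) (h : f (x + l • y) < 1) :
    ∃ η : ℝ, 0 < η ∧ ∀ v u, f (v - x) < η → f (u - y) < η →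
      ∀ m : ℝ, 0 < m → f v < f (v - m • u) := by
  refine ⟨(1 - f (x + l • y)) / (2 + l), div_pos (by linarith) (by linarith), ?_⟩
  intro v u hv hu m hm
  refine hf.lt_sub_smul hl hm ?_
  rw [lt_div_iff₀ (by linarith)] at hv hu
  have h1 := hf.le_add_sub x v
  have h2 := hf.le_add_sub (v + l • u) (x + l • y)
  have h3 := hf.add_le (v - x) (l • (u - y))
  rw [hf.smul _ hl.le] at h3
  have e : v + l • u - (x + l • y) = v - x + l • (u - y) := by
    ext j; simp; ring
  rw [e] at h2
  rw [hf.sub_comm] at h1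
  nlinarith

/-- An integer vector not parallel to `w` stays away from the line spanned by `w`. -/
lemma one_le_of_not_parallel {C : ℝ}
    (hle : ∀ x, ‖x‖ ≤ C * f x) {w z : Fin n → ℤ} (h : ¬ ∀ k l, z k * w l = z l * w k) (t : ℝ) :
    1 ≤ 2 * ‖fun j => (w j : ℝ)‖ * C * f (fun j => (z j : ℝ) + t * w j) := by
  push Not at h
  obtain ⟨k, l, hkl⟩ := h
  set W : Fin n → ℝ := fun j => (w j : ℝ)
  set Z : Fin n → ℝ := fun j => (z j : ℝ) + t * w j
  have h1 : (1 : ℝ) ≤ |(z k : ℝ) * w l - z l * w k| := by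
    exact_mod_cast Int.one_le_abs (sub_ne_zero.2 hkl)
  have e : (z k : ℝ) * w l - z l * w k = Z k * W l - Z l * W k := by
    simp only [Z, W]; ring
  have a1 : |Z k * W l| ≤ ‖Z‖ * ‖W‖ := by
    rw [abs_mul]
    exact mul_le_mul (norm_le_pi_norm Z k) (norm_le_pi_norm W l) (abs_nonneg _) (norm_nonneg _)
  have a2 : |Z l * W k| ≤ ‖Z‖ * ‖W‖ := by
    rw [abs_mul]
    exact mul_le_mul (norm_le_pi_norm Z l) (norm_le_pi_norm W k) (abs_nonneg _) (norm_nonneg _)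
  have a3 := abs_sub (Z k * W l) (Z l * W k)
  rw [e] at h1
  have h2 : ‖Z‖ * ‖W‖ ≤ C * f Z * ‖W‖ := mul_le_mul_of_nonneg_right (hle Z) (norm_nonneg _)
  linarith

end IsGaugeNorm

/-- Every integer point on the line through the origin and `(p, a)` is a multiple of `(p, a)`. -/
def IsPrimitivePoint {n : ℕ} (p : ℤ) (a : Fin n → ℤ) : Prop :=
  ∀ (q : ℤ) (b : Fin n → ℤ), (∀ j, p * b j = q * a j) → ∃ i : ℤ, q = i * p ∧ ∀ j, b j = i * a j

lemma IsPrimitivePoint.exists_basis {n : ℕ} {p : ℤ} (hp : p ≠ 0) {a : Fin n → ℤ}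
    (ha : IsPrimitivePoint p a) {w : Fin n → ℤ} (hw : w ≠ 0) :
    ∃ (q' : ℤ) (b' : Fin n → ℤ),
      (∃ s : ℝ, 0 < s ∧ ∀ j, ((p * b' j - q' * a j : ℤ) : ℝ) = s * w j) ∧
      ∀ (q : ℤ) (b : Fin n → ℤ),
        (∀ k l, (p * b k - q * a k) * w l = (p * b l - q * a l) * w k) →
        ∃ i j : ℤ, q = i * p + j * q' ∧ ∀ k, b k = i * a k + j * b' k := by
  obtain ⟨o, ho⟩ := Function.ne_iff.1 hw
  simp only [Pi.zero_apply] at ho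
  let S : AddSubgroup ℤ :=
    { carrier := {m | ∃ (q : ℤ) (b : Fin n → ℤ), p * b o - q * a o = m ∧
        ∀ k l, (p * b k - q * a k) * w l = (p * b l - q * a l) * w k}
      zero_mem' := ⟨0, 0, by simp, by simp⟩
      add_mem' := by
        rintro _ _ ⟨q, b, rfl, h⟩ ⟨q₁, b₁, rfl, h₁⟩
        refine ⟨q + q₁, b + b₁, by simp only [Pi.add_apply]; ring, fun k l => ?_⟩
        simp only [Pi.add_apply]
        linear_combination h k l + h₁ k l
      neg_mem' := by
        rintro _ ⟨q, b, rfl, h⟩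
        refine ⟨-q, -b, by simp only [Pi.neg_apply]; ring, fun k l => ?_⟩
        simp only [Pi.neg_apply]
        linear_combination - h k l }
  obtain ⟨g, hg⟩ : ∃ g, S = AddSubgroup.zmultiples g := by
    obtain ⟨g, hg⟩ := Int.subgroup_cyclic S
    exact ⟨g, by rw [hg, AddSubgroup.zmultiples_eq_closure]⟩
  have hpw : p * w o ∈ S := ⟨0, w, by simp, fun k l => by ring⟩
  have hg0 : g ≠ 0 := by
    rintro rfl
    rw [hg] at hpw
    simp at hpw
    tauto
  obtain ⟨g', hg'S, hg'⟩ : ∃ g', S = AddSubgroup.zmultiples g' ∧ 0 < g' * w o := by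
    rcases lt_or_gt_of_ne (mul_ne_zero hg0 ho) with h | h
    · exact ⟨-g, by rw [hg, AddSubgroup.zmultiples_neg], by linarith⟩
    · exact ⟨g, hg, h⟩
  have hmem : g' ∈ S := by rw [hg'S]; exact AddSubgroup.mem_zmultiples g'
  obtain ⟨q', b', e, hpar⟩ := hmem
  have hoR : (w o : ℝ) ≠ 0 := by exact_mod_cast ho
  refine ⟨q', b', ⟨g' / w o, ?_, fun j => ?_⟩, fun q b h => ?_⟩
  · have : (0 : ℝ) < g' * w o := by exact_mod_cast hg'
    have h2 : (g' : ℝ) / w o = g' * w o / (w o * w o) := by field_simp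
    rw [h2]
    exact div_pos this (mul_self_pos.2 hoR)
  · have h1 := hpar j o
    rw [e] at h1
    have h2 : ((p * b' j - q' * a j : ℤ) : ℝ) * w o = g' * w j := by exact_mod_cast h1
    field_simp
    linarith
  · have hm : p * b o - q * a o ∈ S := ⟨q, b, rfl, h⟩
    rw [hg'S, AddSubgroup.mem_zmultiples_iff] at hm
    obtain ⟨j, hj⟩ := hm
    rw [smul_eq_mul] at hj
    obtain ⟨i, hi, hi'⟩ := ha (q - j * q') (fun k => b k - j * b' k) fun k => by
      apply mul_right_cancel₀ ho
      linear_combination h k o - j * hpar k o - w k * hj - w k * j * e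
    exact ⟨i, j, by linarith, fun k => by linarith [hi' k]⟩

/-- The rational point `a / p`. -/
noncomputable def ratPoint {n : ℕ} (p : ℤ) (a : Fin n → ℤ) : Fin n → ℝ :=
  fun j => (a j : ℝ) / p

lemma xiv_eq_smul_sub_ratPoint {n : ℕ} (x : Fin n → ℝ) {p : ℤ} (hp : p ≠ 0) (a : Fin n → ℤ) :
    xiv x p a = (p : ℝ) • (x - ratPoint p a) := by
  have : (p : ℝ) ≠ 0 := by exact_mod_cast hp
  ext j
  simp only [xiv, ratPoint, Pi.smul_apply, Pi.sub_apply, smul_eq_mul]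
  field_simp

lemma xiv_eq_add_smul_sub {n : ℕ} (x y : Fin n → ℝ) (q : ℤ) (b : Fin n → ℤ) :
    xiv x q b = xiv y q b + (q : ℝ) • (x - y) := by
  ext j
  simp only [xiv, Pi.add_apply, Pi.smul_apply, Pi.sub_apply, smul_eq_mul]
  ring

lemma xiv_ratPoint_combination {n : ℕ} {p p' : ℤ} (hp' : p' ≠ 0) (a a' : Fin n → ℤ)
    {q i j : ℤ} {b : Fin n → ℤ} (hq : q = i * p + j * p') (hb : ∀ k, b k = i * a k + j * a' k) :
    xiv (ratPoint p' a') q b = (i : ℝ) • xiv (ratPoint p' a') p a := by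
  have : (p' : ℝ) ≠ 0 := by exact_mod_cast hp'
  ext k
  simp only [xiv, ratPoint, Pi.smul_apply, smul_eq_mul, hq, hb k]
  push_cast
  field_simp
  ring

/-- Rational directions are dense, also off a given rational hyperplane. -/
lemma IsGaugeNorm.exists_int_direction {n : ℕ} {f : (Fin n → ℝ) → ℝ} (hf : IsGaugeNorm f)
    (θ : Fin n → ℝ) {ε : ℝ} (hε : 0 < ε) (c : Fin n → ℤ) :
    ∃ (N : ℝ) (w : Fin n → ℤ), 0 < N ∧ f (N • (fun j => (w j : ℝ)) - θ) < ε ∧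
      (c ≠ 0 → ∑ j, c j * w j ≠ 0) := by
  obtain ⟨v, hv, hcv⟩ : ∃ v : Fin n → ℝ, f (v - θ) < ε ∧ (c ≠ 0 → ∑ j, (c j : ℝ) * v j ≠ 0) := by
    by_cases hc : c ≠ 0 ∧ ∑ j, (c j : ℝ) * θ j = 0
    · obtain ⟨hc, h0⟩ := hc
      set d : Fin n → ℝ := fun j => (c j : ℝ)
      have hd : 0 < ∑ j, d j * d j := by
        obtain ⟨o, ho⟩ := Function.ne_iff.1 hc
        refine Finset.sum_pos' (fun j _ => mul_self_nonneg _) ⟨o, Finset.mem_univ _, ?_⟩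
        exact mul_self_pos.2 (by simpa [d] using ho)
      have hfd : 0 ≤ f d := hf.nonneg d
      refine ⟨θ + (ε / (f d + 1)) • d, ?_, fun _ => ?_⟩
      · rw [add_sub_cancel_left, hf.smul _ (by positivity), div_mul_eq_mul_div,
          div_lt_iff₀ (by positivity)]
        linarith
      · have : ∑ j, (c j : ℝ) * (θ + (ε / (f d + 1)) • d) j =
            ∑ j, (c j : ℝ) * θ j + ε / (f d + 1) * ∑ j, d j * d j := by
          rw [Finset.mul_sum, ← Finset.sum_add_distrib]
          refine Finset.sum_congr rfl fun j _ => ?_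
          simp only [Pi.add_apply, Pi.smul_apply, smul_eq_mul, d]; ring
        rw [this, h0, zero_add]
        positivity
    · refine ⟨θ, by simpa [hf.map_zero] using hε, fun h1 h2 => hc ⟨h1, h2⟩⟩
  have hU : IsOpen {u : Fin n → ℝ | f (u - θ) < ε ∧ (c ≠ 0 → ∑ j, (c j : ℝ) * u j ≠ 0)} := by
    refine (isOpen_lt (hf.continuous.comp (by fun_prop)) continuous_const).inter ?_
    by_cases hc : c ≠ 0
    · simp only [hc, ne_eq, not_false_eq_true, true_imp_iff]
      exact isOpen_ne_fun (by fun_prop) continuous_const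
    · simp only [hc, false_imp_iff]
      exact isOpen_const
  obtain ⟨r, hr, hcr⟩ :=
    (DenseRange.piMap fun _ : Fin n => Rat.denseRange_cast (𝕜 := ℝ)).exists_mem_open hU ⟨v, hv, hcv⟩
  obtain ⟨m, hm⟩ := IsLocalization.exist_integer_multiples_of_finite (nonZeroDivisors ℤ) r
  choose w hw using hm
  have hm0 : (m : ℤ) ≠ 0 := nonZeroDivisors.ne_zero m.2
  have hw' : ∀ j, (w j : ℝ) = (m : ℤ) * (r j : ℝ) := fun j => by
    have := hw j
    simp at this
    exact_mod_cast this
  have hmR : ((m : ℤ) : ℝ) ≠ 0 := by exact_mod_cast hm0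
  have hr' : ∀ j, (((m : ℤ) * (m : ℤ) : ℝ))⁻¹ * (((m : ℤ) * w j : ℤ) : ℝ) = r j := fun j => by
    push_cast
    rw [hw' j]
    field_simp
  have e : ((((m : ℤ) * (m : ℤ) : ℝ))⁻¹ • fun j => (((m : ℤ) * w j : ℤ) : ℝ)) =
      Pi.map (fun _ : Fin n => ((↑) : ℚ → ℝ)) r := funext hr'
  refine ⟨(((m : ℤ) * (m : ℤ) : ℝ))⁻¹, fun j => (m : ℤ) * w j,
    inv_pos.2 (mul_self_pos.2 hmR), by rw [e]; exact hr, fun hc h0 => hcr hc ?_⟩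
  have h1 : (((m : ℤ) * (m : ℤ) : ℝ))⁻¹ * ∑ j, (c j : ℝ) * (((m : ℤ) * w j : ℤ) : ℝ) = 0 := by
    have : ∑ j, (c j : ℝ) * (((m : ℤ) * w j : ℤ) : ℝ) = 0 := by exact_mod_cast h0
    rw [this, mul_zero]
  rw [← h1, Finset.mul_sum]
  refine Finset.sum_congr rfl fun j _ => ?_
  rw [Pi.map_apply, ← hr' j]
  ring

/-- A primitive point `(p, a)` has, in every rational direction `w`, a neighbour `(p', a')` such
that the point `a' / p'` is displaced from `a / p` along `w` and the shortest
nonzero remainders with respect to `a' / p'` come from `(p, a)` and `(p', a')` alone. -/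
lemma IsPrimitivePoint.exists_neighbour {n : ℕ} {f : (Fin n → ℝ) → ℝ} (hf : IsGaugeNorm f)
    {p : ℤ} (hp : 1 ≤ p) {a : Fin n → ℤ} (ha : IsPrimitivePoint p a) {w : Fin n → ℤ} (hw : w ≠ 0)
    {c : Fin (n + 1) → ℤ} (hc : c ≠ 0)
    (hcw : (fun j : Fin n => c j.succ) ≠ 0 → ∑ j : Fin n, c j.succ * w j ≠ 0)
    {δ : ℝ} (hδ : 0 < δ) :
    ∃ (p' : ℤ) (a' : Fin n → ℤ), p < p' ∧ IsPrimitivePoint p' a' ∧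
      c 0 * p' + ∑ j : Fin n, c j.succ * a' j ≠ 0 ∧
      (∃ s : ℝ, 0 < s ∧ xiv (ratPoint p' a') p a = s • fun j => (w j : ℝ)) ∧
      f (xiv (ratPoint p' a') p a) ≤ δ ∧
      ∀ (q : ℤ) (b : Fin n → ℤ),
        2 * f (xiv (ratPoint p' a') p a) ≤ f (xiv (ratPoint p' a') q b) ∨
        ∃ i j : ℤ, q = i * p + j * p' ∧ ∀ k, b k = i * a k + j * a' k := by
  obtain ⟨C, hC, hle⟩ := hf.exists_norm_le
  have hp0 : p ≠ 0 := by lia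
  have hpR : (0 : ℝ) < p := by exact_mod_cast hp
  obtain ⟨q', b', ⟨s, hs, hsw⟩, hspan⟩ := ha.exists_basis hp0 hw
  obtain ⟨v, hv⟩ : ∃ v : Fin n → ℤ, ∀ j, v j = p * b' j - q' * a j := ⟨_, fun _ => rfl⟩
  have hvw : ∀ j, (v j : ℝ) = s * w j := fun j => by rw [hv, hsw]
  set vR : Fin n → ℝ := fun j => (v j : ℝ)
  have hvR : vR = s • fun j => (w j : ℝ) := funext hvw
  have hwR : (fun j => (w j : ℝ)) ≠ 0 := fun h => hw <| funext fun j => by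
    simpa using congrFun h j
  have hvR0 : vR ≠ 0 := by rw [hvR]; exact smul_ne_zero hs.ne' hwR
  have hfv : 0 < f vR := hf.pos hvR0
  have hnv : 0 < ‖vR‖ := norm_pos_iff.2 hvR0
  set A : ℤ := c 0 * q' + ∑ j : Fin n, c j.succ * b' j
  set B : ℤ := c 0 * p + ∑ j : Fin n, c j.succ * a j
  have hAB : ¬ (A = 0 ∧ B = 0) := by
    rintro ⟨hA, hB⟩
    have h1 : ∑ j : Fin n, c j.succ * v j = p * A - q' * B := by
      simp only [A, B, mul_add, Finset.mul_sum, hv]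
      have : ∑ j : Fin n, c j.succ * (p * b' j - q' * a j) =
        ∑ j : Fin n, p * (c j.succ * b' j) - ∑ j : Fin n, q' * (c j.succ * a j) := by
        rw [← Finset.sum_sub_distrib]
        exact Finset.sum_congr rfl fun j _ => by ring
      rw [this]; ring
    rw [hA, hB] at h1
    have h2 : s * ((∑ j : Fin n, c j.succ * w j : ℤ) : ℝ) = 0 := by
      have : ((∑ j : Fin n, c j.succ * v j : ℤ) : ℝ) = 0 := by rw [h1]; simp
      rw [← this]
      push_cast
      rw [Finset.mul_sum]
      refine Finset.sum_congr rfl fun j _ => ?_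
      rw [hvw]; ring
    have h3 : ∑ j : Fin n, c j.succ * w j = 0 := by
      have := (mul_eq_zero.1 h2).resolve_left hs.ne'
      exact_mod_cast this
    have h4 : (fun j : Fin n => c j.succ) = 0 := by
      by_contra h
      exact hcw h h3
    have h5 : ∀ j : Fin n, c j.succ = 0 := fun j => congrFun h4 j
    have h6 : c 0 = 0 := by
      simp only [B, h5] at hB
      simpa [hp0] using hB
    exact hc <| funext fun j => by
      refine Fin.cases h6 h5 j
  set M : ℝ := f vR / δ + 4 * ‖vR‖ * C * p * f vR
  obtain ⟨k, hkA, hkq, hkM⟩ : ∃ k : ℤ, |A| < k ∧ |q'| + p < k ∧ |q'| + M < k := by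
    obtain ⟨N, hN⟩ := exists_int_gt (|q'| + M)
    refine ⟨|A| + |q'| + p + |N| + 1, ?_, ?_, ?_⟩
    · have := abs_nonneg q'; have := abs_nonneg N; lia
    · have := abs_nonneg A; have := abs_nonneg N; lia
    · have : N ≤ |A| + |q'| + p + |N| + 1 := by
        have := abs_nonneg A; have := abs_nonneg q'; have := le_abs_self N; lia
      have : (N : ℝ) ≤ (|A| + |q'| + p + |N| + 1 : ℤ) := by exact_mod_cast this
      linarith
  have hk0 : 0 < k := lt_of_le_of_lt (abs_nonneg _) hkA
  obtain ⟨p', hp'⟩ : ∃ p' : ℤ, p' = q' + k * p := ⟨_, rfl⟩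
  obtain ⟨a', ha'⟩ : ∃ a' : Fin n → ℤ, ∀ j, a' j = b' j + k * a j := ⟨_, fun _ => rfl⟩
  have hkp : k ≤ k * p := by nlinarith
  have hq' := neg_abs_le q'
  have hpp' : p < p' := by lia
  have hp'0 : p' ≠ 0 := by lia
  have hp'R : (0 : ℝ) < p' := by exact_mod_cast (by lia : 0 < p')
  have hMp' : M < p' := by
    have h1 : ((k - |q'| : ℤ) : ℝ) ≤ p' := by exact_mod_cast (by lia)
    rw [Int.cast_sub] at h1
    linarith
  have hpa' : ∀ j, p * a' j - p' * a j = v j := fun j => by rw [ha', hp', hv]; ring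
  have hξ : xiv (ratPoint p' a') p a = (p' : ℝ)⁻¹ • vR := by
    ext j
    have := hpa' j
    have : (p : ℝ) * a' j - p' * a j = v j := by exact_mod_cast this
    simp only [xiv, ratPoint, Pi.smul_apply, smul_eq_mul, vR, ← this]
    field_simp
  have hfξ : f (xiv (ratPoint p' a') p a) = f vR / p' := by
    rw [hξ, hf.smul _ (by positivity), div_eq_inv_mul]
  have hM1 : 0 < f vR / δ := by positivity
  have hM2 : 0 < 4 * ‖vR‖ * C * p * f vR := by positivity
  have hsep : ∀ (q : ℤ) (b : Fin n → ℤ),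
        2 * f (xiv (ratPoint p' a') p a) ≤ f (xiv (ratPoint p' a') q b) ∨
        ∃ i j : ℤ, q = i * p + j * p' ∧ ∀ k, b k = i * a k + j * a' k := by
    intro q b
    by_cases hpar : ∀ k l, (p * b k - q * a k) * v l = (p * b l - q * a l) * v k
    · right
      obtain ⟨i, j, hq, hb⟩ := hspan q b fun k l => by
        have h1 : (((p * b k - q * a k : ℤ) : ℝ)) * v l = ((p * b l - q * a l : ℤ) : ℝ) * v k := by
          exact_mod_cast hpar k l
        rw [hvw, hvw] at h1
        have h2 : (((p * b k - q * a k : ℤ) : ℝ)) * w l = ((p * b l - q * a l : ℤ) : ℝ) * w k := by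
          apply mul_left_cancel₀ hs.ne'
          linarith
        exact_mod_cast h2
      refine ⟨i - j * k, j, by rw [hq, hp']; ring, fun l => ?_⟩
      rw [hb, ha']; ring
    · left
      have h1 := IsGaugeNorm.one_le_of_not_parallel hle hpar (-(q / p'))
      have e : (fun j => ((p * b j - q * a j : ℤ) : ℝ) + -(q / p' : ℝ) * v j) =
          (-(p : ℝ)) • xiv (ratPoint p' a') q b := by
        ext j
        have : (v j : ℝ) = p * a' j - p' * a j := by exact_mod_cast (hpa' j).symm
        simp only [xiv, ratPoint, Pi.smul_apply, smul_eq_mul, this]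
        push_cast
        field_simp
        ring
      rw [e, hf.smul_abs, abs_neg, abs_of_pos hpR] at h1
      rw [hfξ, ← mul_div_assoc, div_le_iff₀ hp'R]
      have h2 : 4 * ‖vR‖ * C * p * f vR ≤ p' := by linarith
      have h3 := mul_le_mul_of_nonneg_right h2 (hf.nonneg (xiv (ratPoint p' a') q b))
      have h4 := mul_le_mul_of_nonneg_right h1 (by positivity : 0 ≤ 2 * f vR)
      simp only [vR] at *
      linarith
  refine ⟨p', a', hpp', ?_, ?_, ⟨(p' : ℝ)⁻¹ * s, by positivity, ?_⟩, ?_, hsep⟩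
  · intro q b hqb
    have h0 : xiv (ratPoint p' a') q b = 0 := by
      ext j
      have : (p' : ℝ) * b j = q * a' j := by exact_mod_cast hqb j
      simp only [xiv, ratPoint, Pi.zero_apply]
      field_simp
      linarith
    have hpos : 0 < f vR / p' := by positivity
    rcases hsep q b with h | ⟨i, j, hq, hb⟩
    · rw [h0, hf.map_zero, hfξ] at h
      linarith
    · have h1 := xiv_ratPoint_combination hp'0 a a' hq hb
      rw [h0, hξ] at h1
      have hi : i = 0 := by
        have := (smul_eq_zero.1 h1.symm).resolve_right
          (smul_ne_zero (inv_ne_zero hp'R.ne') hvR0)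
        exact_mod_cast this
      subst hi
      exact ⟨j, by simpa using hq, by simpa using hb⟩
  · have e : c 0 * p' + ∑ j : Fin n, c j.succ * a' j = A + k * B := by
      simp only [A, B, hp', ha', mul_add, Finset.sum_add_distrib, Finset.mul_sum]
      have : ∀ j : Fin n, c j.succ * (k * a j) = k * (c j.succ * a j) := fun j => by ring
      simp only [this]
      ring
    rw [e]
    intro h
    by_cases hB : B = 0
    · exact hAB ⟨by simpa [hB] using h, hB⟩
    · have h1 : |A| = k * |B| := by
        rw [show A = -(k * B) by lia, abs_neg, abs_mul, abs_of_pos hk0]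
      have := Int.one_le_abs hB
      nlinarith
  · rw [hξ, hvR, smul_smul]
  · rw [hfξ, div_le_iff₀ hp'R, ← div_le_iff₀' hδ]
    linarith

/-- A ball around a rational point, intersected with a thin cone around the direction `θ`, contains
a smaller ball around another rational point; at those points of the smaller ball that lie in a thin
cone around `θ'`, the old rational point beats all others below the new denominator. -/
lemma IsPrimitivePoint.exists_next {n : ℕ} {f : (Fin n → ℝ) → ℝ} (hf : IsGaugeNorm f)
    {θ θ' : Fin n → ℝ} {ε ε' : ℝ} (hε : 0 < ε) (hε1 : ε ≤ 1) (hθ : f θ = 1)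
    (hill : ∀ v u, f (v - θ) < ε → f (u - θ') < ε' → ∀ m : ℝ, 0 < m → f v < f (v - m • u))
    {p : ℤ} (hp : 1 ≤ p) {a : Fin n → ℤ} (ha : IsPrimitivePoint p a) {ρ : ℝ} (hρ : 0 < ρ)
    {c : Fin (n + 1) → ℤ} (hc : c ≠ 0) :
    ∃ (p' : ℤ) (a' : Fin n → ℤ) (ρ' : ℝ), p < p' ∧ IsPrimitivePoint p' a' ∧ 0 < ρ' ∧
      (∀ x, f (x - ratPoint p' a') ≤ ρ' →
        f (x - ratPoint p a) ≤ ρ ∧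
        (∃ t : ℝ, 0 < t ∧ f (x - ratPoint p a - t • θ) < ε * t) ∧
        (c 0 : ℝ) + ∑ j : Fin n, (c j.succ : ℝ) * x j ≠ 0) ∧
      ∀ x, f (x - ratPoint p' a') ≤ ρ' →
        (∃ t : ℝ, 0 < t ∧ f (x - ratPoint p' a' - t • θ') < ε' * t) →
        ∀ (q : ℤ) (b : Fin n → ℤ), 1 ≤ q → q < p' → ¬ (q = p ∧ b = a) →
          f (xiv x p a) < f (xiv x q b) := by
  have hpR : (1 : ℝ) ≤ p := by exact_mod_cast hp
  have hp0 : p ≠ 0 := by lia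
  obtain ⟨N, w, hN, hNw, hcw⟩ := hf.exists_int_direction θ hε (fun j : Fin n => c j.succ)
  set wR : Fin n → ℝ := fun j => (w j : ℝ)
  have hw : w ≠ 0 := by
    rintro rfl
    have : wR = 0 := by ext j; simp [wR]
    rw [this, smul_zero, zero_sub, hf.neg, hθ] at hNw
    linarith
  obtain ⟨p', a', hpp', ha', hc', ⟨s, hs, hsw⟩, hδ, hsep⟩ :=
    ha.exists_neighbour hf hp hw hc hcw (half_pos hρ)
  have hp'0 : p' ≠ 0 := by lia
  have hp'R : (0 : ℝ) < p' := by exact_mod_cast (by lia : 0 < p')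
  set α' := ratPoint p' a'
  set α := ratPoint p a
  set F := f (xiv α' p a) with hF
  have hxα : xiv α' p a = (p : ℝ) • (α' - α) := xiv_eq_smul_sub_ratPoint _ hp0 _
  have hFα : F = p * f (α' - α) := by rw [hF, hxα, hf.smul _ (by linarith)]
  set t₀ : ℝ := s / (p * N)
  have ht₀ : 0 < t₀ := by positivity
  have hαt : α' - α = t₀ • (N • wR) := by
    have h1 : (p : ℝ) • (α' - α) = (p : ℝ) • (t₀ • (N • wR)) := by
      rw [← hxα, hsw, smul_smul, smul_smul]
      congr 1
      simp only [t₀]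
      field_simp
    exact smul_right_injective _ (by linarith : (p : ℝ) ≠ 0) h1
  have hF0 : 0 < F := by
    refine hf.pos ?_
    rw [hsw]
    refine smul_ne_zero hs.ne' fun h => hw <| funext fun j => ?_
    simpa [wR] using congrFun h j
  obtain ⟨r, hr, hcr⟩ : ∃ r : ℝ, 0 < r ∧ ∀ x, f (x - α') ≤ r →
      (c 0 : ℝ) + ∑ j : Fin n, (c j.succ : ℝ) * x j ≠ 0 := by
    obtain ⟨C, hC, hle⟩ := hf.exists_norm_le
    have hopen : IsOpen {x : Fin n → ℝ | (c 0 : ℝ) + ∑ j : Fin n, (c j.succ : ℝ) * x j ≠ 0} :=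
      isOpen_ne_fun (by fun_prop) continuous_const
    have hmem : α' ∈ {x : Fin n → ℝ | (c 0 : ℝ) + ∑ j : Fin n, (c j.succ : ℝ) * x j ≠ 0} := by
      intro h
      have h1 : (p' : ℝ) * ((c 0 : ℝ) + ∑ j : Fin n, (c j.succ : ℝ) * α' j) = 0 := by
        rw [h, mul_zero]
      apply hc'
      have h2 : ((c 0 * p' + ∑ j : Fin n, c j.succ * a' j : ℤ) : ℝ) = 0 := by
        rw [← h1, mul_add, Finset.mul_sum]
        push_cast
        congr 1
        · ring
        · refine Finset.sum_congr rfl fun j _ => ?_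
          simp only [α', ratPoint]
          field_simp
      exact_mod_cast h2
    obtain ⟨d, hd, hball⟩ := Metric.isOpen_iff.1 hopen α' hmem
    refine ⟨d / (2 * C), by positivity, fun x hx => hball ?_⟩
    rw [Metric.mem_ball, dist_eq_norm]
    have h1 := mul_le_mul_of_nonneg_left hx hC.le
    have h2 : C * (d / (2 * C)) = d / 2 := by field_simp
    linarith [hle (x - α')]
  set κ := ε - f (N • wR - θ)
  have hκ : 0 < κ := by simp only [κ]; linarith
  obtain ⟨ρ', hρ', hρ'1⟩ : ∃ ρ' : ℝ, 0 < ρ' ∧ ρ' < min (min (ρ / 2) r) (min (t₀ * κ) (F / (2 * p'))) :=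
    exists_between (by positivity)
  simp only [lt_min_iff] at hρ'1
  obtain ⟨⟨hρ1, hρ2⟩, hρ3, hρ4⟩ := hρ'1
  rw [lt_div_iff₀ (by positivity)] at hρ4
  have hcone : ∀ x, f (x - α') ≤ ρ' → f (x - α - t₀ • θ) < ε * t₀ := fun x hx => by
    have e : x - α - t₀ • θ = (x - α') + t₀ • (N • wR - θ) := by
      rw [smul_sub, ← hαt]; abel
    rw [e]
    refine (hf.add_le _ _).trans_lt ?_
    rw [hf.smul _ ht₀.le]
    simp only [κ] at hρ3
    linarith
  refine ⟨p', a', ρ', hpp', ha', hρ', fun x hx => ⟨?_, ⟨t₀, ht₀, hcone x hx⟩,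
    hcr x (hx.trans hρ2.le)⟩, ?_⟩
  · have h1 := hf.add_le (x - α') (α' - α)
    rw [sub_add_sub_cancel] at h1
    have h2 : f (α' - α) ≤ F := by
      rw [hFα]; nlinarith [hf.nonneg (α' - α)]
    linarith
  · rintro x hx ⟨t, ht, hxt⟩ q b hq hqp' hne
    by_cases hfar : 2 * F ≤ f (xiv α' q b)
    · have h1 := hf.add_le (xiv α' p a) ((p : ℝ) • (x - α'))
      rw [← xiv_eq_add_smul_sub, hf.smul _ (by linarith)] at h1
      have h2 := hf.add_le (xiv x q b) ((q : ℝ) • (α' - x))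
      have hq0 : (0 : ℝ) ≤ q := by exact_mod_cast (by lia : 0 ≤ q)
      rw [← xiv_eq_add_smul_sub, hf.smul _ hq0, hf.sub_comm] at h2
      have h3 : (p : ℝ) * f (x - α') ≤ p' * ρ' :=
        mul_le_mul (by exact_mod_cast hpp'.le) hx (hf.nonneg _) hp'R.le
      have h4 : (q : ℝ) * f (x - α') ≤ p' * ρ' :=
        mul_le_mul (by exact_mod_cast hqp'.le) hx (hf.nonneg _) hp'R.le
      linarith
    · obtain ⟨i, j, hqij, hbij⟩ := (hsep q b).resolve_left hfar
      have hcomb := xiv_ratPoint_combination hp'0 a a' hqij hbij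
      have hi : |i| < 2 := by
        rw [hcomb, hf.smul_abs] at hfar
        have h1 : |(i : ℝ)| < 2 := by
          by_contra! h
          exact hfar (mul_le_mul_of_nonneg_right h hF0.le)
        exact_mod_cast h1
      rw [abs_lt] at hi
      have hj : (i = 1 ∧ j = 0) ∨ (i = -1 ∧ j = 1) := by
        have : i = -1 ∨ i = 0 ∨ i = 1 := by lia
        have hj0 : -1 < j := by
          by_contra! h
          rcases this with rfl | rfl | rfl <;> nlinarith
        have hj1 : j < 2 := by
          by_contra! h
          rcases this with rfl | rfl | rfl <;> nlinarith
        obtain rfl | rfl : j = 0 ∨ j = 1 := by lia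
        all_goals rcases this with rfl | rfl | rfl <;> lia
      rcases hj with ⟨rfl, rfl⟩ | ⟨rfl, rfl⟩
      · exact absurd ⟨by simpa using hqij, funext fun k => by simpa using hbij k⟩ hne
      · set y := x - α
        set u := t⁻¹ • (x - α')
        have hy : f (t₀⁻¹ • y - θ) < ε := by
          have e : t₀⁻¹ • y - θ = t₀⁻¹ • (x - α - t₀ • θ) := by
            rw [smul_sub _ _ (t₀ • θ), inv_smul_smul₀ ht₀.ne']
          rw [e, hf.smul _ (by positivity), inv_mul_lt_iff₀ ht₀, mul_comm]
          exact hcone x hx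
        have hu : f (u - θ') < ε' := by
          have e : u - θ' = t⁻¹ • (x - α' - t • θ') := by
            rw [smul_sub _ _ (t • θ'), inv_smul_smul₀ ht.ne']
          rw [e, hf.smul _ (by positivity), inv_mul_lt_iff₀ ht, mul_comm]
          exact hxt
        have h1 := hill _ _ hy hu (p' * t / (p * t₀)) (by positivity)
        have hpt : (0 : ℝ) < p * t₀ := by positivity
        have h2 := mul_lt_mul_of_pos_left h1 hpt
        rw [← hf.smul _ hpt.le, ← hf.smul _ hpt.le] at h2
        have e1 : ((p : ℝ) * t₀) • t₀⁻¹ • y = xiv x p a := by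
          rw [xiv_eq_smul_sub_ratPoint x hp0, smul_smul]
          congr 1
          field_simp
        have e2 : ((p : ℝ) * t₀) • ((p' * t / (p * t₀)) • u) = xiv x p' a' := by
          rw [xiv_eq_smul_sub_ratPoint x hp'0, smul_smul, smul_smul]
          congr 1
          field_simp
        have e3 : xiv x p a - xiv x p' a' = - xiv x q b := by
          ext k
          simp only [xiv, Pi.sub_apply, Pi.neg_apply, hqij, hbij k]
          push_cast
          ring
        rw [smul_sub _ (t₀⁻¹ • y) (_ • u), e1, e2, e3, hf.neg] at h2
        exact h2

/-- If, for each `ν`, the remainder of `(p ν, a ν)` is strictly shorter than that of any other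
point with denominator below `p (ν + 1)`, then these points are all the best approximations. -/
lemma IsFBSASeq.eq_of_forall_lt {n : ℕ} {f : (Fin n → ℝ) → ℝ} {α : Fin n → ℝ} {p : ℕ → ℤ}
    {a : ℕ → Fin n → ℤ} (hp0 : p 0 = 1) (hp : StrictMono p)
    (h : ∀ (ν : ℕ) (q : ℤ) (b : Fin n → ℤ), 1 ≤ q → q < p (ν + 1) → ¬ (q = p ν ∧ b = a ν) →
      f (xiv α (p ν) (a ν)) < f (xiv α q b))
    {τ : ℕ → ℤ × (Fin n → ℤ)} (hτ : IsFBSASeq f α τ) (ν : ℕ) : τ ν = (p ν, a ν) := by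
  have hp1 : ∀ ν, 1 ≤ p ν := fun ν => hp0 ▸ hp.monotone (Nat.zero_le ν)
  have hbest : ∀ ν, IsFBSA f α (p ν) (a ν) := fun ν =>
    ⟨hp1 ν, fun q b hq hqp => h ν q b hq (by linarith [hp (Nat.lt_succ_self ν)])
      fun hh => by lia,
    fun b hb => h ν _ b (hp1 ν) (hp (Nat.lt_succ_self ν)) fun hh => hb hh.2⟩
  have hge : ∀ ν : ℕ, (ν : ℤ) < p ν := fun ν => by
    induction ν with
    | zero => simp [hp0]
    | succ k ih => have := hp (Nat.lt_succ_self k); push_cast; lia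
  have hall : ∀ (q : ℤ) (b : Fin n → ℤ), IsFBSA f α q b → ∃ ν, q = p ν ∧ b = a ν := by
    intro q b hq
    have hex : ∃ m, q < p m := ⟨q.toNat, by have := hge q.toNat; lia⟩
    obtain ⟨m, hm, hmin⟩ : ∃ m, q < p m ∧ ∀ k < m, ¬ q < p k :=
      ⟨Nat.find hex, Nat.find_spec hex, fun k hk => Nat.find_min hex hk⟩
    obtain _ | k := m
    · rw [hp0] at hm
      exact absurd hq.1 (by lia)
    have hk : p k ≤ q := not_lt.1 (hmin k (Nat.lt_succ_self k))
    refine ⟨k, by_contra fun hne => ?_⟩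
    have h1 := h k q b hq.1 hm hne
    rcases hk.lt_or_eq with hlt | heq
    · exact lt_asymm h1 (hq.2.1 (p k) (a k) (hp1 k) (by lia))
    · have := hq.2.2 (a k) fun hh => hne ⟨heq.symm, hh.symm⟩
      rw [← heq] at this h1
      exact lt_asymm h1 this
  have hτmono : StrictMono fun ν => (τ ν).1 := strictMono_nat_of_lt_succ hτ.2.1
  have hrange : Set.range (fun ν => (τ ν).1) = Set.range p := by
    ext q
    constructor
    · rintro ⟨k, rfl⟩
      obtain ⟨m, hm, -⟩ := hall _ _ (hτ.1 k)
      exact ⟨m, hm.symm⟩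
    · rintro ⟨k, rfl⟩
      obtain ⟨m, hm⟩ := hτ.2.2 _ _ (hbest k)
      exact ⟨m, by simp [hm]⟩
  have heq : ∀ k, (τ k).1 = p k := fun k => congrFun ((hτmono.range_inj hp).1 hrange) k
  obtain ⟨m, hm, hm'⟩ := hall _ _ (hτ.1 ν)
  obtain rfl : ν = m := hp.injective (by rw [← heq, hm])
  exact Prod.ext hm hm'

lemma IsGaugeNorm.normalize_sub_le {n : ℕ} {f : (Fin n → ℝ) → ℝ} (hf : IsGaugeNorm f)
    {θ y : Fin n → ℝ} (hθ : f θ = 1) {ε t : ℝ} (ht : 0 < t) (hε1 : ε ≤ 1)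
    (h : f (y - t • θ) < ε * t) : f ((f y)⁻¹ • y - θ) ≤ 2 * f (t⁻¹ • y - θ) ∧
      f (t⁻¹ • y - θ) < ε := by
  set u := t⁻¹ • y
  have hyu : y = t • u := (smul_inv_smul₀ ht.ne' y).symm
  have hu : f (u - θ) < ε := by
    have e : y - t • θ = t • (u - θ) := by rw [smul_sub, ← hyu]
    rw [e, hf.smul _ ht.le, mul_comm] at h
    exact lt_of_mul_lt_mul_right h ht.le
  refine ⟨?_, hu⟩
  have h1 := hf.le_add_sub θ u
  have h2 := hf.le_add_sub u θ
  rw [hf.sub_comm, hθ] at h1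
  rw [hθ] at h2
  have hu0 : 0 < f u := by linarith
  have e : (f y)⁻¹ • y = (f u)⁻¹ • u := by
    rw [hyu, hf.smul _ ht.le, smul_smul]
    congr 1
    field_simp
  have h3 := hf.add_le ((f u)⁻¹ • u - u) (u - θ)
  have e2 : (f u)⁻¹ • u - u = ((f u)⁻¹ - 1) • u := by rw [sub_smul, one_smul]
  have e3 : |(f u)⁻¹ - 1| * f u = |1 - f u| := by
    nth_rewrite 2 [← abs_of_pos hu0]
    rw [← abs_mul, sub_mul, inv_mul_cancel₀ hu0.ne', one_mul]
  rw [sub_add_sub_cancel, e2, hf.smul_abs _ u, e3] at h3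
  have h4 : |1 - f u| ≤ f (u - θ) := abs_le.2 ⟨by linarith, by linarith⟩
  rw [e]
  linarith

/-- If for each `ν` the point `0 ∈ ∂B_f^1(θ_ν)` is illuminated from
`θ_{ν+1}` (so `f(θ_ν) = 1`, `f(θ_{ν+1} − θ_ν) > 1` and `f(−λθ_{ν+1} − θ_ν) < 1` for some
`λ > 0`), then there is `α` with `1, α₁, …, α_n` linearly independent over `ℚ` whose
normalized remainders satisfy `|Ξ_ν − θ_ν| → 0`. -/
theorem stmt16 (n : ℕ) (f : (Fin n → ℝ) → ℝ) (hf : IsGaugeNorm f)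
    (θ : ℕ → Fin n → ℝ)
    (hθ : ∀ ν : ℕ, f (θ ν) = 1 ∧ 1 < f (θ (ν + 1) - θ ν) ∧
      ∃ lam : ℝ, 0 < lam ∧ f (-(lam • θ (ν + 1)) - θ ν) < 1) :
    ∃ α : Fin n → ℝ,
      (∀ c : Fin (n + 1) → ℤ,
        ((c 0 : ℝ) + ∑ j : Fin n, (c j.succ : ℝ) * α j = 0) → c = 0) ∧
      ∀ τ : ℕ → ℤ × (Fin n → ℤ), IsFBSASeq f α τ →
        Filter.Tendsto (fun ν : ℕ => ‖Xiv f α τ ν - θ ν‖) Filter.atTop (nhds 0) := by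
  obtain ⟨C, hC, hle⟩ := hf.exists_norm_le
  have hη : ∀ ν, ∃ η : ℝ, 0 < η ∧ ∀ v u, f (v - θ ν) < η → f (u - θ (ν + 1)) < η →
      ∀ m : ℝ, 0 < m → f v < f (v - m • u) := fun ν => by
    obtain ⟨h1, -, l, hl, h2⟩ := hθ ν
    refine hf.exists_illumination_radius h1 hl ?_
    rwa [← hf.neg, neg_add, ← sub_eq_add_neg, show -θ ν - l • θ (ν + 1) = -(l • θ (ν + 1)) - θ ν by abel]
  choose η hη0 hη using hη
  set ε : ℕ → ℝ := fun ν => min (1 / ((ν : ℝ) + 1)) (min (η ν) (η (ν - 1)))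
  have hε0 : ∀ ν, 0 < ε ν := fun ν =>
    lt_min (by positivity) (lt_min (hη0 _) (hη0 _))
  have hεle : ∀ ν, ε ν ≤ 1 / ((ν : ℝ) + 1) := fun ν => min_le_left _ _
  have hε1 : ∀ ν, ε ν ≤ 1 := fun ν => (hεle ν).trans <| by
    rw [div_le_one (by positivity)]
    linarith [(Nat.cast_nonneg ν : (0 : ℝ) ≤ ν)]
  have hill : ∀ ν v u, f (v - θ ν) < ε ν → f (u - θ (ν + 1)) < ε (ν + 1) →
      ∀ m : ℝ, 0 < m → f v < f (v - m • u) := fun ν v u hv hu =>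
    hη ν v u (hv.trans_le ((min_le_right _ _).trans (min_le_left _ _)))
      (hu.trans_le ((min_le_right _ _).trans (min_le_right _ _)))
  have : Nonempty {c : Fin (n + 1) → ℤ // c ≠ 0} := ⟨⟨1, one_ne_zero⟩⟩
  obtain ⟨c, hc⟩ := exists_surjective_nat {c : Fin (n + 1) → ℤ // c ≠ 0}
  let S := {s : ℤ × (Fin n → ℤ) × ℝ // 1 ≤ s.1 ∧ IsPrimitivePoint s.1 s.2.1 ∧ 0 < s.2.2}
  have hstep : ∀ (ν : ℕ) (s : S), ∃ s' : S, s.1.1 < s'.1.1 ∧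
      (∀ x, f (x - ratPoint s'.1.1 s'.1.2.1) ≤ s'.1.2.2 →
        f (x - ratPoint s.1.1 s.1.2.1) ≤ s.1.2.2 ∧
        (∃ t : ℝ, 0 < t ∧ f (x - ratPoint s.1.1 s.1.2.1 - t • θ ν) < ε ν * t) ∧
        ((c ν).1 0 : ℝ) + ∑ j : Fin n, ((c ν).1 j.succ : ℝ) * x j ≠ 0) ∧
      ∀ x, f (x - ratPoint s'.1.1 s'.1.2.1) ≤ s'.1.2.2 →
        (∃ t : ℝ, 0 < t ∧
          f (x - ratPoint s'.1.1 s'.1.2.1 - t • θ (ν + 1)) < ε (ν + 1) * t) →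
        ∀ (q : ℤ) (b : Fin n → ℤ), 1 ≤ q → q < s'.1.1 → ¬ (q = s.1.1 ∧ b = s.1.2.1) →
          f (xiv x s.1.1 s.1.2.1) < f (xiv x q b) := by
    rintro ν ⟨⟨p, a, ρ⟩, hp, ha, hρ⟩
    obtain ⟨p', a', ρ', h1, h2, h3, h4, h5⟩ :=
      ha.exists_next hf (hε0 ν) (hε1 ν) (hθ ν).1 (hill ν) hp hρ (c ν).2
    exact ⟨⟨(p', a', ρ'), by simp only at hp ⊢; lia, h2, h3⟩, h1, h4, h5⟩
  choose next hnext using hstep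
  let s₀ : S := ⟨(1, 0, 1), le_rfl, fun q b h => ⟨q, by simp, by simpa using h⟩, one_pos⟩
  let s : ℕ → S := fun ν => Nat.rec s₀ next ν
  have hs : ∀ ν, s (ν + 1) = next ν (s ν) := fun _ => rfl
  set p : ℕ → ℤ := fun ν => (s ν).1.1
  set a : ℕ → Fin n → ℤ := fun ν => (s ν).1.2.1
  set ρ : ℕ → ℝ := fun ν => (s ν).1.2.2
  have hmono : StrictMono p := strictMono_nat_of_lt_succ fun ν => (hnext ν (s ν)).1
  let B : ℕ → Set (Fin n → ℝ) := fun ν => {x | f (x - ratPoint (p ν) (a ν)) ≤ ρ ν}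
  have hsucc : ∀ ν x, x ∈ B (ν + 1) → x ∈ B ν ∧
        (∃ t : ℝ, 0 < t ∧ f (x - ratPoint (p ν) (a ν) - t • θ ν) < ε ν * t) ∧
        ((c ν).1 0 : ℝ) + ∑ j : Fin n, ((c ν).1 j.succ : ℝ) * x j ≠ 0 :=
    fun ν => (hnext ν (s ν)).2.1
  have hclosed : ∀ ν, IsClosed (B ν) := fun ν =>
    isClosed_le (hf.continuous.comp (by fun_prop)) continuous_const
  have hcompact : IsCompact (B 0) := by
    refine (isCompact_closedBall (ratPoint (p 0) (a 0)) (C * ρ 0)).of_isClosed_subset (hclosed 0)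
      fun x hx => ?_
    rw [Metric.mem_closedBall, dist_eq_norm]
    exact (hle _).trans (mul_le_mul_of_nonneg_left hx hC.le)
  obtain ⟨α, hα⟩ := hcompact.nonempty_iInter_of_sequence_nonempty_isCompact_isClosed B
    (fun ν x hx => (hsucc ν x hx).1)
    (fun ν => ⟨ratPoint (p ν) (a ν), by
      simp only [B, Set.mem_ofPred_eq, sub_self, hf.map_zero]
      exact (s ν).2.2.2.le⟩) hclosed
  rw [Set.mem_iInter] at hα
  have hcone := fun ν => (hsucc ν α (hα (ν + 1))).2.1
  refine ⟨α, fun d hd => ?_, fun τ hτ => ?_⟩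
  · by_contra hd0
    obtain ⟨ν, hν⟩ := hc ⟨d, hd0⟩
    refine (hsucc ν α (hα (ν + 1))).2.2 ?_
    rw [hν]
    exact hd
  · have hτeq := hτ.eq_of_forall_lt (p := p) (a := a) rfl hmono fun ν =>
      (hnext ν (s ν)).2.2 α (hα (ν + 1)) (hcone (ν + 1))
    have hbound : ∀ ν, ‖Xiv f α τ ν - θ ν‖ ≤ C * 2 * (1 / ((ν : ℝ) + 1)) := fun ν => by
      obtain ⟨t, ht, htα⟩ := hcone ν
      have hpν : (0 : ℝ) < p ν := by
        have := (s ν).2.1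
        exact_mod_cast (by lia : 0 < (s ν).1.1)
      have e : Xiv f α τ ν =
          (f (α - ratPoint (p ν) (a ν)))⁻¹ • (α - ratPoint (p ν) (a ν)) := by
        have hp0 : p ν ≠ 0 := by exact_mod_cast hpν.ne'
        rw [Xiv, hτeq ν, xiv_eq_smul_sub_ratPoint α hp0, hf.smul _ hpν.le, smul_smul]
        congr 1
        rw [mul_inv, mul_right_comm, inv_mul_cancel₀ hpν.ne', one_mul]
      obtain ⟨h1, h2⟩ := hf.normalize_sub_le (hθ ν).1 ht (hε1 ν) htα
      rw [e, mul_assoc]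
      refine (hle _).trans (mul_le_mul_of_nonneg_left ?_ hC.le)
      linarith [hεle ν]
    refine squeeze_zero (fun _ => norm_nonneg _) hbound ?_
    simpa using tendsto_one_div_add_atTop_nhds_zero_nat.const_mul (C * 2)
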